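/- For every p ∈ (0,1], the function ψ_p attains its minimum over (0,∞) at the point y = p/(1+p) if and only if 8p³ + 4p² ≥ 1. -/

import Mathlib

/-- `ψ_p^{k,m}(y) = y·[(k(1 + p·m) − m(1 − p + p·m)) / (k(1 − p + p·k))]
                    + (1 + p·m)/(1 − p + p·k)`. -/
noncomputable def psiKM (p : ℝ) (k m : ℕ) (y : ℝ) : ℝ :=
  y * (((k : ℝ) * (1 + p * (m : ℝ)) - (m : ℝ) * (1 - p + p * (m : ℝ)))
        / ((k : ℝ) * (1 - p + p * (k : ℝ))))
    + (1 + p * (m : ℝ)) / (1 - p + p * (k : ℝ))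

/-- `ψ_p(y) = sup { ψ_p^{k,m}(y) : k, m ∈ ℕ, k ≥ 1 }`. -/
noncomputable def psiSup (p y : ℝ) : ℝ :=
  ⨆ km : ℕ × ℕ, psiKM p (km.1 + 1) km.2 y

open Filter Topology

/-- The numerator of `psiKM` after putting it over the common denominator `k (1 - p + p k)`. -/
noncomputable def psiNum (p k m y : ℝ) : ℝ :=
  y * (k * (1 + p * m) - m * (1 - p + p * m)) + k * (1 + p * m)

/-- The limit `(1 + y)² / (4 y)` of `sup_m ψ_p^{k,m}(y)` as `k → ∞`. -/
noncomputable def psiLim (y : ℝ) : ℝ := (1 + y) ^ 2 / (4 * y)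

lemma psiKM_succ_eq {p : ℝ} (hp0 : 0 < p) (hp1 : p ≤ 1) (k m : ℕ) (y : ℝ) :
    psiKM p (k + 1) m y
      = psiNum p (k + 1) m y / (((k : ℝ) + 1) * (1 - p + p * ((k : ℝ) + 1))) := by
  have hk : (0 : ℝ) < (k : ℝ) + 1 := by positivity
  have hd : (0 : ℝ) < 1 - p + p * ((k : ℝ) + 1) := by nlinarith [mul_pos hp0 hk]
  unfold psiKM psiNum
  push_cast
  field_simp

lemma psi_denom_pos {p : ℝ} (hp0 : 0 < p) (hp1 : p ≤ 1) (k : ℕ) :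
    (0 : ℝ) < ((k : ℝ) + 1) * (1 - p + p * ((k : ℝ) + 1)) := by
  have hk : (0 : ℝ) < (k : ℝ) + 1 := by positivity
  have := mul_pos hp0 hk
  exact mul_pos hk (by linarith)

lemma psiKM_succ_le_iff {p : ℝ} (hp0 : 0 < p) (hp1 : p ≤ 1) (k m : ℕ) (y B : ℝ) :
    psiKM p (k + 1) m y ≤ B ↔
      psiNum p (k + 1) m y ≤ B * (((k : ℝ) + 1) * (1 - p + p * ((k : ℝ) + 1))) := by
  rw [psiKM_succ_eq hp0 hp1, div_le_iff₀ (psi_denom_pos hp0 hp1 k)]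

/-- Completing the square around `m = s k`, where `s = (1 + y) / (2 y)`. -/
lemma psiNum_eq {y s : ℝ} (hy : 0 < y) (hs : s = (1 + y) / (2 * y)) (p k m : ℝ) :
    psiNum p k m y = psiLim y * (k * (1 - p + p * k))
      + y * (k * s * (1 + p - (1 - p) * s) - (1 - p) * (m - s * k) - p * (m - s * k) ^ 2) := by
  subst hs
  unfold psiNum psiLim
  field_simp
  ring

/-- Maximising the quadratic in `m` over the reals. -/
lemma psiNum_le {p y s : ℝ} (hp0 : 0 < p) (hy : 0 < y) (hs : s = (1 + y) / (2 * y)) (k m : ℝ) :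
    psiNum p k m y ≤ psiLim y * (k * (1 - p + p * k))
      + y * (k * s * (1 + p - (1 - p) * s) + (1 - p) ^ 2 / (4 * p)) := by
  rw [psiNum_eq hy hs]
  have h : -(1 - p) * (m - s * k) - p * (m - s * k) ^ 2
      = (1 - p) ^ 2 / (4 * p) - p * ((m - s * k) + (1 - p) / (2 * p)) ^ 2 := by
    field_simp
    ring
  have h2 : 0 ≤ p * ((m - s * k) + (1 - p) / (2 * p)) ^ 2 := by positivity
  gcongr
  linarith

lemma psiKM_bddAbove {p y : ℝ} (hp0 : 0 < p) (hp1 : p ≤ 1) (hy : 0 < y) :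
    BddAbove (Set.range fun km : ℕ × ℕ => psiKM p (km.1 + 1) km.2 y) := by
  obtain ⟨s, hs⟩ : ∃ s, s = (1 + y) / (2 * y) := ⟨_, rfl⟩
  have hs0 : 0 < s := by rw [hs]; positivity
  have hC : 0 ≤ y * (s * (1 + p) + (1 - p) ^ 2 / (4 * p)) := by positivity
  refine ⟨psiLim y + y * (s * (1 + p) + (1 - p) ^ 2 / (4 * p)), ?_⟩
  rintro _ ⟨⟨k, m⟩, rfl⟩
  refine (psiKM_succ_le_iff hp0 hp1 k m y _).2 ((psiNum_le hp0 hy hs _ _).trans ?_)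
  have hk : (0 : ℝ) ≤ k := k.cast_nonneg
  have hden : (k : ℝ) + 1 ≤ ((k : ℝ) + 1) * (1 - p + p * ((k : ℝ) + 1)) := by
    nlinarith [mul_nonneg hp0.le hk, mul_nonneg (mul_nonneg hp0.le hk) hk]
  have hle : ((k : ℝ) + 1) * s * (1 + p - (1 - p) * s) + (1 - p) ^ 2 / (4 * p)
      ≤ (s * (1 + p) + (1 - p) ^ 2 / (4 * p)) * ((k : ℝ) + 1) := by
    have h1 : 0 ≤ (1 - p) ^ 2 / (4 * p) * k := by positivity
    have h2 : 0 ≤ ((k : ℝ) + 1) * s * ((1 - p) * s) :=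
      mul_nonneg (by positivity) (mul_nonneg (by linarith) hs0.le)
    linarith
  have h3 := mul_le_mul_of_nonneg_left hle hy.le
  have h4 := mul_le_mul_of_nonneg_left hden hC
  linarith

lemma psiKM_le_psiSup {p y : ℝ} (hp0 : 0 < p) (hp1 : p ≤ 1) (hy : 0 < y) (k m : ℕ) :
    psiKM p (k + 1) m y ≤ psiSup p y :=
  le_ciSup (psiKM_bddAbove hp0 hp1 hy) (k, m)

lemma psiLim_le_psiSup {p y : ℝ} (hp0 : 0 < p) (hp1 : p ≤ 1) (hy : 0 < y) :
    psiLim y ≤ psiSup p y := by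
  by_contra! hlt
  obtain ⟨s, hs⟩ : ∃ s, s = (1 + y) / (2 * y) := ⟨_, rfl⟩
  have hs0 : 0 < s := by rw [hs]; positivity
  obtain ⟨c, hc⟩ : ∃ c, c = |s * (1 + p - (1 - p) * s)| := ⟨_, rfl⟩
  have hpd : 0 < (psiLim y - psiSup p y) * p := mul_pos (by linarith) hp0
  obtain ⟨k, hk⟩ := exists_nat_gt (y * (c + 1) / ((psiLim y - psiSup p y) * p))
  rw [div_lt_iff₀ hpd] at hk
  have hk0 : (0 : ℝ) ≤ k := k.cast_nonneg
  have hsk : 0 ≤ s * ((k : ℝ) + 1) := by positivity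
  have hfl := Nat.floor_le hsk
  have hfl' := Nat.lt_floor_add_one (s * ((k : ℝ) + 1))
  have hle := (psiKM_succ_le_iff hp0 hp1 k ⌊s * ((k : ℝ) + 1)⌋₊ y _).1
    (psiKM_le_psiSup hp0 hp1 hy k _)
  rw [psiNum_eq hy hs] at hle
  obtain ⟨t, ht⟩ : ∃ t, t = (⌊s * ((k : ℝ) + 1)⌋₊ : ℝ) - s * ((k : ℝ) + 1) := ⟨_, rfl⟩
  rw [← ht] at hle
  have ht0 : t ≤ 0 := by linarith
  have ht1 : -1 ≤ t := by linarith
  have hquad : -1 ≤ -(1 - p) * t - p * t ^ 2 := by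
    nlinarith [mul_nonneg (sub_nonneg.2 hp1) (neg_nonneg.2 ht0),
      mul_nonneg hp0.le (mul_nonneg (neg_nonneg.2 ht0) (neg_le_iff_add_nonneg.1 ht1))]
  have hlin : -c * ((k : ℝ) + 1) ≤ ((k : ℝ) + 1) * s * (1 + p - (1 - p) * s) := by
    have := neg_abs_le (s * (1 + p - (1 - p) * s))
    rw [← hc] at this
    nlinarith
  have hD : -(c + 1) * ((k : ℝ) + 1) ≤ ((k : ℝ) + 1) * s * (1 + p - (1 - p) * s)
      - (1 - p) * t - p * t ^ 2 := by linarith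
  have hyD := mul_le_mul_of_nonneg_left hD hy.le
  have hcancel : (psiLim y - psiSup p y) * (1 - p + p * ((k : ℝ) + 1)) * ((k : ℝ) + 1)
      ≤ y * (c + 1) * ((k : ℝ) + 1) := by linarith
  have hcancel := le_of_mul_le_mul_right hcancel (by positivity)
  linarith

lemma psiNum_one_sub (p m y : ℝ) :
    psiNum p 1 m y - (1 + p + p * y) = (m - 1) * (p - y * (1 + p * (m - 1))) := by
  unfold psiNum
  ring

/-- For `k = 1` the value `m = 1` is optimal on `[p / (1 + p), p / (1 - p)]`. -/
lemma psiNum_one_le {p y : ℝ} (hp0 : 0 < p) (hy : 0 < y) (h1 : p ≤ y * (1 + p))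
    (h2 : y * (1 - p) ≤ p) (m : ℕ) : psiNum p 1 m y ≤ 1 + p + p * y := by
  rw [← sub_nonpos, psiNum_one_sub]
  rcases m with _ | _ | m
  · push_cast; linarith
  · simp
  · push_cast
    have : 0 ≤ (m : ℝ) := m.cast_nonneg
    apply mul_nonpos_of_nonneg_of_nonpos
    · linarith
    · nlinarith [mul_nonneg (mul_nonneg hy.le hp0.le) this]

lemma psiNum_high_le {p : ℝ} (hp0 : 0 < p) (k m : ℝ) :
    psiNum p k m (p / (1 + p))
      ≤ (k * (1 + 2 * p) + (k * (1 + 2 * p) - (1 - p)) ^ 2 / 4) / (1 + p) := by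
  have h : (k * (1 + 2 * p) + (k * (1 + 2 * p) - (1 - p)) ^ 2 / 4) / (1 + p)
      - psiNum p k m (p / (1 + p)) = (p * m - (k * (1 + 2 * p) - (1 - p)) / 2) ^ 2 / (1 + p) := by
    unfold psiNum
    field_simp
    ring
  have : 0 ≤ (p * m - (k * (1 + 2 * p) - (1 - p)) / 2) ^ 2 / (1 + p) := by positivity
  linarith

lemma high_mem {p : ℝ} (hp0 : 0 < p) : p ≤ p / (1 + p) * (1 + p) ∧ p / (1 + p) * (1 - p) < p := by
  constructor
  · field_simp; rfl
  · rw [div_mul_eq_mul_div, div_lt_iff₀ (by positivity)]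
    nlinarith

lemma psiSup_high_le {p : ℝ} (hp0 : 0 < p) (hp1 : p ≤ 1) (h : 1 ≤ 8 * p ^ 3 + 4 * p ^ 2) :
    psiSup p (p / (1 + p)) ≤ 1 + p + p * (p / (1 + p)) := by
  have hy : 0 < p / (1 + p) := by positivity
  refine ciSup_le fun ⟨k, m⟩ => (psiKM_succ_le_iff hp0 hp1 k m _ _).2 ?_
  rcases k with _ | j
  · have := psiNum_one_le hp0 hy (high_mem hp0).1 (high_mem hp0).2.le m
    simpa using this
  · refine (psiNum_high_le hp0 _ _).trans ?_
    rw [div_le_iff₀ (by positivity)]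
    have hV : (1 + p + p * (p / (1 + p))) * (1 + p) = 1 + 2 * p + 2 * p ^ 2 := by
      field_simp
      ring
    rw [mul_right_comm, hV]
    push_cast
    have hj : (0 : ℝ) ≤ j := j.cast_nonneg
    have hpl : 3 / 8 < p := by
      by_contra! hle
      nlinarith [mul_nonneg hp0.le hp0.le, mul_nonneg (mul_nonneg hp0.le hp0.le) (sub_nonneg.2 hle),
        mul_nonneg hp0.le (sub_nonneg.2 hle)]
    have hA : 0 ≤ 8 * p ^ 3 + 4 * p ^ 2 - 1 := by linarith
    have hlin : 0 ≤ 24 * p ^ 3 + 12 * p ^ 2 - 2 * p - 2 := by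
      nlinarith [mul_pos hp0 hp0, mul_nonneg hp0.le (sub_nonneg.2 hpl.le),
        mul_nonneg (mul_pos hp0 hp0).le (sub_nonneg.2 hpl.le)]
    have hconst : 0 ≤ 16 * p ^ 3 + 7 * p ^ 2 - 2 * p - 1 := by
      nlinarith [mul_pos hp0 hp0, mul_nonneg hp0.le (sub_nonneg.2 hpl.le),
        mul_nonneg (mul_pos hp0 hp0).le (sub_nonneg.2 hpl.le)]
    nlinarith [mul_nonneg hA (mul_nonneg hj hj), mul_nonneg hlin hj]

lemma high_value_le_psiSup {p y : ℝ} (hp0 : 0 < p) (hp1 : p ≤ 1) (hy : 0 < y) :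
    1 + p + p * (p / (1 + p)) ≤ psiSup p y := by
  have hy0 : p / (1 + p) * (1 + p) = p := by field_simp
  rcases le_total (p / (1 + p)) y with h | h
  · refine le_trans ?_ (psiKM_le_psiSup hp0 hp1 hy 0 1)
    have : psiKM p (0 + 1) 1 y = 1 + p + p * y := by
      simp [psiKM]; ring
    rw [this]
    gcongr
  · refine le_trans ?_ (psiKM_le_psiSup hp0 hp1 hy 0 2)
    have : psiKM p (0 + 1) 2 y = 1 + 2 * p - y := by
      simp [psiKM]; ring
    rw [this]
    linarith

/-- Past `k = 1`, every `ψ_p^{k,m}(y)` is bounded by the limit `psiLim y`. -/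
lemma psiSup_le_max {p y s : ℝ} (hp0 : 0 < p) (hp1 : p ≤ 1) (hy : 0 < y)
    (hs : s = (1 + y) / (2 * y)) (h1 : p ≤ y * (1 + p)) (h2 : y * (1 - p) ≤ p)
    (h3 : (1 - p) ^ 2 / (4 * p) ≤ 2 * s * ((1 - p) * s - (1 + p))) :
    psiSup p y ≤ max (psiLim y) (1 + p + p * y) := by
  refine ciSup_le fun ⟨k, m⟩ => ?_
  rcases k with _ | j
  · refine le_max_of_le_right ((psiKM_succ_le_iff hp0 hp1 0 m _ _).2 ?_)
    simpa using psiNum_one_le hp0 hy h1 h2 m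
  · refine le_max_of_le_left ((psiKM_succ_le_iff hp0 hp1 (j + 1) m _ _).2
      ((psiNum_le hp0 hy hs _ _).trans ?_))
    have hj : (0 : ℝ) ≤ j := j.cast_nonneg
    have hq : 0 ≤ (1 - p) ^ 2 / (4 * p) := by positivity
    have hfac : 0 ≤ j * (s * ((1 - p) * s - (1 + p))) := mul_nonneg hj (by linarith)
    have : (((j + 1 : ℕ) : ℝ) + 1) * s * (1 + p - (1 - p) * s) + (1 - p) ^ 2 / (4 * p) ≤ 0 := by
      push_cast
      linarith
    linarith [mul_nonpos_of_nonneg_of_nonpos hy.le this]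

lemma psiLim_lt_psiLim {x y : ℝ} (hx : 0 < x) (hxy : x < y) (hy : y ≤ 1) :
    psiLim y < psiLim x := by
  have hy0 : 0 < y := hx.trans hxy
  unfold psiLim
  rw [div_lt_div_iff₀ (by positivity) (by positivity)]
  have : x * y < 1 := by nlinarith
  nlinarith [mul_pos (sub_pos.2 hxy) (sub_pos.2 this)]

lemma exists_psiSup_lt {p : ℝ} (hp0 : 0 < p) (hp1 : p ≤ 1) (h : 8 * p ^ 3 + 4 * p ^ 2 < 1) :
    ∃ y, 0 < y ∧ psiSup p y < psiSup p (p / (1 + p)) := by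
  have hy0 : 0 < p / (1 + p) := by positivity
  have hpu : p < 2 / 5 := by
    by_contra! hle
    nlinarith [mul_nonneg hp0.le (sub_nonneg.2 hle),
      mul_nonneg (mul_pos hp0 hp0).le (sub_nonneg.2 hle)]
  have e1 : ∀ᶠ y in 𝓝 (p / (1 + p)), y * (1 - p) < p :=
    (by fun_prop : Continuous fun y : ℝ => y * (1 - p)).continuousAt.tendsto.eventually_lt_const
      (high_mem hp0).2
  have e2 : ∀ᶠ y in 𝓝 (p / (1 + p)), 1 + p + p * y < psiLim (p / (1 + p)) := by
    refine (by fun_prop : Continuous fun y : ℝ => 1 + p + p * y).continuousAt.tendsto.eventually_lt_const ?_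
    have : psiLim (p / (1 + p)) - (1 + p + p * (p / (1 + p)))
        = (1 - (8 * p ^ 3 + 4 * p ^ 2)) / (4 * p * (1 + p)) := by
      unfold psiLim
      field_simp
      ring
    have h2 : 0 < (1 - (8 * p ^ 3 + 4 * p ^ 2)) / (4 * p * (1 + p)) :=
      div_pos (by linarith) (by positivity)
    linarith
  have e3 : ∀ᶠ y in 𝓝 (p / (1 + p)), (1 - p) ^ 2 / (4 * p)
      < 2 * ((1 + y) / (2 * y)) * ((1 - p) * ((1 + y) / (2 * y)) - (1 + p)) := by
    refine Tendsto.eventually_const_lt (v := 2 * ((1 + p / (1 + p)) / (2 * (p / (1 + p))))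
      * ((1 - p) * ((1 + p / (1 + p)) / (2 * (p / (1 + p)))) - (1 + p))) ?_ ?_
    · have hs : (1 + p / (1 + p)) / (2 * (p / (1 + p))) = (1 + 2 * p) / (2 * p) := by
        field_simp
        ring
      rw [hs, ← sub_pos]
      have : 2 * ((1 + 2 * p) / (2 * p)) * ((1 - p) * ((1 + 2 * p) / (2 * p)) - (1 + p))
          - (1 - p) ^ 2 / (4 * p) = (2 + p - 10 * p ^ 2 - 17 * p ^ 3) / (4 * p ^ 2) := by
        field_simp
        ring
      rw [this]
      refine div_pos ?_ (by positivity)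
      nlinarith [mul_pos hp0 (sub_pos.2 hpu), mul_pos (mul_pos hp0 hp0) (sub_pos.2 hpu)]
    · have : ContinuousAt (fun y : ℝ => (1 + y) / (2 * y)) (p / (1 + p)) :=
        ContinuousAt.div (by fun_prop) (by fun_prop) (by positivity)
      exact (this.const_mul 2).mul ((this.const_mul (1 - p)).sub continuousAt_const)
  have e4 : ∀ᶠ y in 𝓝 (p / (1 + p)), y < 1 :=
    eventually_lt_nhds (by rw [div_lt_one (by positivity)]; linarith)
  obtain ⟨y, ⟨⟨h1, h2⟩, h3, h4⟩, hy⟩ :=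
    ((((e1.and e2).and (e3.and e4)).filter_mono nhdsWithin_le_nhds).and
      (self_mem_nhdsWithin : Set.Ioi (p / (1 + p)) ∈ 𝓝[>] (p / (1 + p)))).exists
  have hyp : 0 < y := hy0.trans hy
  refine ⟨y, hyp, ?_⟩
  have hlow : p ≤ y * (1 + p) := ((div_lt_iff₀ (by positivity)).1 hy).le
  exact (psiSup_le_max hp0 hp1 hyp rfl hlow h1.le h3.le).trans_lt
    ((max_lt (psiLim_lt_psiLim hy0 hy h4.le) h2).trans_le (psiLim_le_psiSup hp0 hp1 hy0))

/-- For every `p ∈ (0,1]`, `ψ_p` attains its minimum over `(0,∞)` at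
`y = p/(1+p)` if and only if `8p³ + 4p² ≥ 1`. -/
theorem psi_min_at_high_iff (p : ℝ) (hp0 : 0 < p) (hp1 : p ≤ 1) :
    (∀ y : ℝ, 0 < y → psiSup p (p / (1 + p)) ≤ psiSup p y)
      ↔ 1 ≤ 8 * p ^ 3 + 4 * p ^ 2 := by
  constructor
  · intro hmin
    by_contra! hlt
    obtain ⟨y, hy, hlt'⟩ := exists_psiSup_lt hp0 hp1 hlt
    exact absurd (hmin y hy) hlt'.not_ge
  · intro h y hy
    exact (psiSup_high_le hp0 hp1 h).trans (high_value_le_psiSup hp0 hp1 hy)
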